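/- Let n ≥ 2 be an even integer, let α_1 = α_2 = 1/2 and α_3 = 1/n, and let f(g) be the number of α-communal compositions of g. Then the generating function satisfies the formal power series identity Σ_{g=0}^∞ f(g)·x^g · (1 − x^{2})(1 − x^{n})^{2} = 1 + x^{n+1}. -/

import Mathlib

open PowerSeries in
lemma mk_mul_one_sub_X_pow {R : Type*} [CommRing R] (a : ℕ → R) (k : ℕ) :
    mk a * (1 - X ^ k) = mk fun g => a g - if k ≤ g then a (g - k) else 0 := by
  ext g
  simp [mul_sub, coeff_mul_X_pow']

/-- Compositions of `g` with bounds `1/2, 1/2, 1/n`, in terms of the third and the first part. -/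
def communalEquiv (n g : ℕ) (hn : 2 ≤ n) :
    {t : Fin 3 → ℕ // (∑ i, t i) = g ∧
      ∀ i, (t i : ℚ) ≤ ![(1 : ℚ)/2, 1/2, 1/(n : ℚ)] i * (g : ℚ)} ≃
    (Finset.range (g / n + 1)).sigma
      (fun c => Finset.Ico (g / 2 + g % 2 - c) (g / 2 + 1)) := by
  have hn0 : (0 : ℚ) < n := by exact_mod_cast (by omega : 0 < n)
  have half (a : ℕ) : (a : ℚ) ≤ 2⁻¹ * g ↔ 2 * a ≤ g := by
    rw [← @Nat.cast_le ℚ]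
    push_cast
    constructor <;> intro h <;> linarith
  have third (c : ℕ) : (c : ℚ) ≤ (n : ℚ)⁻¹ * g ↔ c ≤ g / n := by
    rw [Nat.le_div_iff_mul_le (by omega), ← @Nat.cast_le ℚ, inv_mul_eq_div, le_div_iff₀ hn0]
    push_cast
    rfl
  have hq : g / n ≤ g / 2 := Nat.div_le_div_left hn (by norm_num)
  refine
    { toFun := fun t => ⟨⟨t.1 2, t.1 0⟩, ?_⟩
      invFun := fun p => ⟨![p.1.2, g - p.1.1 - p.1.2, p.1.1], ?_⟩
      left_inv := ?_
      right_inv := ?_ }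
  · obtain ⟨t, hsum, hle⟩ := t
    simp [Fin.sum_univ_three, Fin.forall_fin_succ, half, third] at hsum hle
    simp only [Finset.mem_sigma, Finset.mem_range, Finset.mem_Ico]
    omega
  · obtain ⟨⟨c, a⟩, hp⟩ := p
    simp only [Finset.mem_sigma, Finset.mem_range, Finset.mem_Ico] at hp
    simp only [Fin.sum_univ_three, Fin.forall_fin_succ]
    simp [half, third, -Nat.cast_sub]
    omega
  · rintro ⟨t, hsum, hle⟩
    simp only [Fin.sum_univ_three] at hsum
    ext i
    fin_cases i
    · rfl
    · simp
      omega
    · rfl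
  · rintro ⟨⟨c, a⟩, hp⟩
    rfl

lemma card_communal (n g : ℕ) (hn : 2 ≤ n) :
    (Nat.card {t : Fin 3 → ℕ // (∑ i, t i) = g ∧
      ∀ i, (t i : ℚ) ≤ ![(1 : ℚ)/2, 1/2, 1/(n : ℚ)] i * (g : ℚ)} : ℚ) =
    if Even g then ((g / n : ℕ) + 1 : ℚ) * ((g / n : ℕ) + 2) / 2
    else ((g / n : ℕ) : ℚ) * ((g / n : ℕ) + 1) / 2 := by
  have hq : g / n ≤ g / 2 := Nat.div_le_div_left hn (by norm_num)
  have sum_id (q : ℕ) : ∑ c ∈ Finset.range (q + 1), (c : ℚ) = q * (q + 1) / 2 := by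
    induction q with
    | zero => simp
    | succ q ih =>
      rw [Finset.sum_range_succ, ih]
      push_cast
      ring
  rw [Nat.card_congr (communalEquiv n g hn), Nat.card_eq_fintype_card, Fintype.card_coe,
    Finset.card_sigma]
  simp only [Nat.card_Ico]
  have term : ∀ c ∈ Finset.range (g / n + 1),
      g / 2 + 1 - (g / 2 + g % 2 - c) = c + (1 - g % 2) := by
    intro c hc
    rw [Finset.mem_range] at hc
    omega
  rw [Finset.sum_congr rfl term]
  push_cast
  rw [Finset.sum_add_distrib, sum_id]
  split_ifs with h
  · rw [Nat.even_iff.mp h]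
    simp
    ring
  · rw [Nat.not_even_iff.mp h]
    simp

/-- For `α = (1/2, 1/2, 1/n)` with `n ≥ 2` even, the generating
function satisfies `(∑ g, f(g)·x^g)·(1−x²)(1−xⁿ)² = 1 + x^{n+1}` over ℚ. -/
theorem stmt_18 (n : ℕ) (hn : 2 ≤ n) (heven : Even n) (f : ℕ → ℕ)
    (hf : ∀ g : ℕ, f g = Nat.card
      {t : Fin 3 → ℕ // (∑ i, t i) = g ∧
        ∀ i, (t i : ℚ) ≤ ![(1 : ℚ)/2, 1/2, 1/(n : ℚ)] i * (g : ℚ)}) :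
    (PowerSeries.mk fun g => (f g : ℚ)) *
        ((1 - PowerSeries.X ^ 2) * (1 - PowerSeries.X ^ n) ^ 2)
      = 1 + PowerSeries.X ^ (n + 1) := by
  have quot {g : ℕ} (h : n ≤ g) : ((g / n : ℕ) : ℚ) = ((g - n) / n : ℕ) + 1 := by
    rw [Nat.div_eq_sub_div (by omega) h]
    push_cast
    rfl
  have first : (PowerSeries.mk fun g => (f g : ℚ)) * (1 - PowerSeries.X ^ n) =
      PowerSeries.mk fun g => if Even g then ((g / n : ℕ) + 1 : ℚ) else (g / n : ℕ) := by
    rw [mk_mul_one_sub_X_pow]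
    congr 1
    funext g
    rw [hf, hf, card_communal n g hn, card_communal n (g - n) hn]
    by_cases h : n ≤ g
    · simp only [h, if_true, Nat.even_sub h, heven, iff_true, quot h]
      split_ifs <;> ring
    · simp [h, Nat.div_eq_of_lt (not_le.mp h)]
  have second : (PowerSeries.mk fun g => if Even g then ((g / n : ℕ) + 1 : ℚ) else (g / n : ℕ)) *
      (1 - PowerSeries.X ^ n) =
      PowerSeries.mk fun g => if Even g ∨ n ≤ g then (1 : ℚ) else 0 := by
    rw [mk_mul_one_sub_X_pow]
    congr 1
    funext g
    by_cases h : n ≤ g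
    · simp only [h, if_true, Nat.even_sub h, heven, iff_true, quot h, or_true]
      split_ifs <;> ring
    · simp [h, Nat.div_eq_of_lt (not_le.mp h)]
  calc _ = (PowerSeries.mk fun g => (f g : ℚ)) * (1 - PowerSeries.X ^ n) *
        (1 - PowerSeries.X ^ n) * (1 - PowerSeries.X ^ 2) := by ring
    _ = _ := by
      rw [first, second, mk_mul_one_sub_X_pow]
      ext g
      simp only [PowerSeries.coeff_mk, map_add, PowerSeries.coeff_one, PowerSeries.coeff_X_pow]
      rw [Nat.even_iff] at heven
      simp only [Nat.even_iff]
      split_ifs <;> first | omega | norm_num
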